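/- Fix integers 1 ≤ d < D, reals κ > 0 and 0 < σ < κ. There exist constants C > 0 and γ₀ > 0, depending only on κ, σ, d, D, such that for all 0 < γ ≤ γ₀, the sets M₀ and M₁ of the bump construction satisfy V((M₀ ⊕ σ) △ (M₁ ⊕ σ)) ≤ C γ^{(d+2)/2}, where △ denotes symmetric difference. -/

import Mathlib

open Metric MeasureTheory

open Metric

/-- The point `(u, v, 0) ∈ ℝ^D`, where the first `d` coordinates are those of `u`,
the `(d+1)`-st coordinate is `v`, and the remaining `D - d - 1` coordinates vanish. -/
noncomputable def bumpPt (d D : ℕ) (u : EuclideanSpace ℝ (Fin d)) (v : ℝ) :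
    EuclideanSpace ℝ (Fin D) :=
  (WithLp.equiv 2 ((_ : Fin D) → ℝ)).symm
    (fun i => if h : (i : ℕ) < d then u ⟨i, h⟩ else if (i : ℕ) = d then v else 0)

/-- The profile function `a(u)` of the unperturbed manifold `M₀`. -/
noncomputable def bumpA (d : ℕ) (κ : ℝ) (u : EuclideanSpace ℝ (Fin d)) : ℝ :=
  if ‖u‖ ≤ 1 then κ else Real.sqrt (κ ^ 2 - (‖u‖ - 1) ^ 2)

/-- The profile function `b(u)` of the perturbed manifold `M₁`, with bump height `γ`. -/
noncomputable def bumpB (d : ℕ) (κ γ : ℝ) (u : EuclideanSpace ℝ (Fin d)) : ℝ :=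
  if ‖u‖ ≤ Real.sqrt (4 * κ * γ - γ ^ 2) / 2 then γ + Real.sqrt (κ ^ 2 - ‖u‖ ^ 2)
  else if ‖u‖ ≤ Real.sqrt (4 * κ * γ - γ ^ 2) then
    2 * κ - Real.sqrt (κ ^ 2 - (‖u‖ - Real.sqrt (4 * κ * γ - γ ^ 2)) ^ 2)
  else bumpA d κ u

/-- The manifold `M₀` of the bump construction. -/
noncomputable def bumpM₀ (d D : ℕ) (κ : ℝ) : Set (EuclideanSpace ℝ (Fin D)) :=
  {y | ∃ u : EuclideanSpace ℝ (Fin d), ‖u‖ ≤ 1 + κ ∧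
    (y = bumpPt d D u (bumpA d κ u) ∨ y = bumpPt d D u (-bumpA d κ u))}

/-- The perturbed manifold `M₁` of the bump construction. -/
noncomputable def bumpM₁ (d D : ℕ) (κ γ : ℝ) : Set (EuclideanSpace ℝ (Fin D)) :=
  {y | ∃ u : EuclideanSpace ℝ (Fin d), ‖u‖ ≤ 1 + κ ∧
    (y = bumpPt d D u (bumpB d κ γ u) ∨ y = bumpPt d D u (-bumpA d κ u))}

/-- The closed `σ`-neighborhood `M ⊕ σ = {y : infDist(y, M) ≤ σ}` of a set `M`. -/
def tubeNbhd {E : Type*} [PseudoMetricSpace E] (M : Set E) (σ : ℝ) : Set E :=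
  {y | Metric.infDist y M ≤ σ}


/-- first d coordinates -/
noncomputable def uP (d D : ℕ) (h : d < D) (y : EuclideanSpace ℝ (Fin D)) :
    EuclideanSpace ℝ (Fin d) := WithLp.toLp 2 fun j => y (Fin.castLE h.le j)

/-- remaining coordinates -/
noncomputable def wP (d D : ℕ) (y : EuclideanSpace ℝ (Fin D)) :
    EuclideanSpace ℝ {i : Fin D // ¬ (i : ℕ) < d} := WithLp.toLp 2 fun j => y j.1

/-- the unit vector in the v direction -/
noncomputable def eP (d D : ℕ) : EuclideanSpace ℝ {i : Fin D // ¬ (i : ℕ) < d} :=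
  WithLp.toLp 2 fun j => if (j.1 : ℕ) = d then 1 else 0

/-- reindexing -/
def castEq (d D : ℕ) (h : d < D) : Fin d ≃ {i : Fin D // (i : ℕ) < d} where
  toFun j := ⟨Fin.castLE h.le j, by simp⟩
  invFun i := ⟨i.1, i.2⟩
  left_inv j := by simp
  right_inv i := by ext; simp

lemma eP_norm (d D : ℕ) (h : d < D) : ‖eP d D‖ = 1 := by
  have : ‖eP d D‖ ^ 2 = 1 := by
    rw [EuclideanSpace.norm_sq_eq]
    rw [Finset.sum_eq_single (⟨⟨d, h⟩, by simp⟩ : {i : Fin D // ¬ (i : ℕ) < d})]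
    · simp [eP]
    · intro b _ hb
      have : (b.1 : ℕ) ≠ d := fun hh => hb (by ext; simpa using hh)
      simp [eP, this]
    · simp
  nlinarith [norm_nonneg (eP d D)]

lemma dist_sq_bump (d D : ℕ) (h : d < D) (y : EuclideanSpace ℝ (Fin D))
    (u : EuclideanSpace ℝ (Fin d)) (v : ℝ) :
    dist y (bumpPt d D u v) ^ 2 = ‖uP d D h y - u‖ ^ 2 + ‖wP d D y - v • eP d D‖ ^ 2 := by
  rw [dist_eq_norm, EuclideanSpace.norm_sq_eq, EuclideanSpace.norm_sq_eq,
    EuclideanSpace.norm_sq_eq, ← Fintype.sum_subtype_add_sum_subtype (fun i : Fin D => (i : ℕ) < d)]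
  congr 1
  · rw [← Equiv.sum_comp (castEq d D h)]
    apply Finset.sum_congr rfl
    intro i _
    simp [castEq, uP, bumpPt]
  · apply Finset.sum_congr rfl
    intro i _
    simp [wP, eP, bumpPt, i.2]

lemma core {E : Type*} [NormedAddCommGroup E] [NormedSpace ℝ E] (x u' : E)
    (t s γ σ r : ℝ) (hγ : 0 < γ) (hσ : 0 < σ) (hγσ : γ ≤ σ) (hs : σ < s) (hs' : s ≤ σ + γ)
    (hsmall : 48 * (γ * σ) ≤ 1) (ht : 0 ≤ t)
    (hr : r ≤ 1 / 2) (hu' : ‖u'‖ ≤ r)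
    (h1 : ∃ tp, 0 ≤ tp ∧ t ≤ tp + γ ∧ ‖x - u'‖ ^ 2 + tp ^ 2 < s ^ 2)
    (h2 : ∀ u'' : E, ‖u''‖ ≤ 1 → ∃ tq, 0 ≤ tq ∧ tq ≤ t + γ ∧ s ^ 2 ≤ ‖x - u''‖ ^ 2 + tq ^ 2) :
    ‖x‖ ^ 2 ≤ 2 * (r ^ 2 + 12 * (γ * σ)) ∧ σ - γ ≤ t ∧ t ≤ σ + 2 * γ := by
  obtain ⟨tp, htp, htt, h1⟩ := h1
  have htps : tp < s := by
    apply lt_of_pow_lt_pow_left₀ 2 (by linarith)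
    nlinarith [sq_nonneg ‖x - u'‖]
  have hsq : (t + γ) ^ 2 ≤ tp ^ 2 + 12 * (γ * σ) := by
    have : (t + γ) ^ 2 ≤ (tp + 2 * γ) ^ 2 := by
      apply pow_le_pow_left₀ <;> linarith
    have h3 : γ * tp ≤ γ * (σ + γ) := by gcongr; linarith
    have h4 : γ * γ ≤ γ * σ := by gcongr
    nlinarith
  have htri : ‖x‖ ≤ ‖x - u'‖ + ‖u'‖ := by
    simpa using norm_add_le (x - u') u'
  by_cases hx : ‖x‖ ≤ 1
  · obtain ⟨tq, hq0, hq1, hq2⟩ := h2 x hx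
    have hq3 : tq ^ 2 ≤ (t + γ) ^ 2 := by gcongr
    simp at hq2
    refine ⟨?_, ?_, by linarith⟩
    · have h5 : ‖x‖ ^ 2 ≤ (‖x - u'‖ + r) ^ 2 := by gcongr; linarith
      nlinarith [sq_nonneg (‖x - u'‖ - r)]
    · have := (le_abs_self s).trans (abs_le_of_sq_le_sq hq2 hq0)
      linarith
  · exfalso
    push Not at hx
    obtain ⟨tq, hq0, hq1, hq2⟩ := h2 (‖x‖⁻¹ • x) (by
      rw [norm_smul, norm_inv, norm_norm, inv_mul_cancel₀ (by linarith)])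
    have hq3 : tq ^ 2 ≤ (t + γ) ^ 2 := by gcongr
    have hn : ‖x - ‖x‖⁻¹ • x‖ = ‖x‖ - 1 := by
      have : x - ‖x‖⁻¹ • x = (1 - ‖x‖⁻¹) • x := by rw [sub_smul, one_smul]
      rw [this, norm_smul, Real.norm_of_nonneg, sub_mul, one_mul, inv_mul_cancel₀ (by linarith)]
      have := inv_le_one_of_one_le₀ hx.le
      linarith
    rw [hn] at hq2
    have h6 : (‖x‖ - 1 / 2) ^ 2 ≤ ‖x - u'‖ ^ 2 := by
      apply pow_le_pow_left₀ <;> linarith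
    nlinarith

lemma bumpB_bounds (d : ℕ) (κ γ : ℝ) (u : EuclideanSpace ℝ (Fin d)) (hκ : 0 < κ) (hγ : 0 < γ)
    (hγκ : γ ≤ κ) (hu : ‖u‖ ≤ 1) : κ ≤ bumpB d κ γ u ∧ bumpB d κ γ u ≤ κ + γ := by
  unfold bumpB
  have hr0 := Real.sqrt_nonneg (4 * κ * γ - γ ^ 2)
  have hr2 : Real.sqrt (4 * κ * γ - γ ^ 2) ^ 2 = 4 * κ * γ - γ ^ 2 :=
    Real.sq_sqrt (by nlinarith)
  set r := Real.sqrt (4 * κ * γ - γ ^ 2)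
  have key : ∀ x : ℝ, |x| ≤ r / 2 → κ - γ / 2 ≤ √(κ ^ 2 - x ^ 2) ∧ √(κ ^ 2 - x ^ 2) ≤ κ := by
    intro x hx
    have : x ^ 2 ≤ (r / 2) ^ 2 := sq_le_sq' (by linarith [(abs_le.1 hx).1]) (abs_le.1 hx).2
    constructor
    · apply Real.le_sqrt_of_sq_le; nlinarith
    · apply Real.sqrt_le_iff.2; constructor <;> nlinarith [sq_nonneg x]
  split_ifs with h1 h2
  · have := key ‖u‖ (by rwa [abs_norm])
    constructor <;> linarith
  · have := key (‖u‖ - r) (by rw [abs_le]; constructor <;> linarith)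
    constructor <;> linarith
  · simp [bumpA, hu, hγ.le]

lemma geom (d D : ℕ) (hdD : d < D) (κ σ γ : ℝ) (hκ : 0 < κ) (hσ : 0 < σ)
    (hγ : 0 < γ) (hγκ : γ ≤ κ) (hγσ : γ ≤ σ) (h48 : 48 * (γ * σ) ≤ 1) (h16 : 16 * (κ * γ) ≤ 1)
    (y : EuclideanSpace ℝ (Fin D))
    (hy : y ∈ symmDiff (tubeNbhd (bumpM₀ d D κ) σ) (tubeNbhd (bumpM₁ d D κ γ) σ)) :
    ‖uP d D hdD y‖ ^ 2 ≤ (8 * κ + 24 * σ) * γ ∧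
      σ - γ ≤ ‖wP d D y - κ • eP d D‖ ∧ ‖wP d D y - κ • eP d D‖ ≤ σ + 2 * γ := by
  have hr0 := Real.sqrt_nonneg (4 * κ * γ - γ ^ 2)
  have hr2 : Real.sqrt (4 * κ * γ - γ ^ 2) ^ 2 = 4 * κ * γ - γ ^ 2 :=
    Real.sq_sqrt (by nlinarith)
  set r := Real.sqrt (4 * κ * γ - γ ^ 2) with hrdef
  have hr : r ≤ 1 / 2 := by nlinarith
  have hA : ∀ u : EuclideanSpace ℝ (Fin d), ‖u‖ ≤ 1 → bumpA d κ u = κ := by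
    intro u hu; simp [bumpA, hu]
  have hBA : ∀ u : EuclideanSpace ℝ (Fin d), r < ‖u‖ → bumpB d κ γ u = bumpA d κ u := by
    intro u hu
    unfold bumpB
    rw [← hrdef, if_neg (by linarith), if_neg (by linarith)]
  -- abstract version
  have main : ∀ (M M' : Set (EuclideanSpace ℝ (Fin D))), M.Nonempty →
      (∀ p ∈ M, p ∉ M' → ∃ u' h', ‖u'‖ ≤ r ∧ κ ≤ h' ∧ h' ≤ κ + γ ∧ p = bumpPt d D u' h') →
      (∀ u : EuclideanSpace ℝ (Fin d), ‖u‖ ≤ 1 →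
        ∃ h', κ ≤ h' ∧ h' ≤ κ + γ ∧ bumpPt d D u h' ∈ M') →
      y ∈ tubeNbhd M σ → y ∉ tubeNbhd M' σ →
      ‖uP d D hdD y‖ ^ 2 ≤ 2 * (r ^ 2 + 12 * (γ * σ)) ∧
      σ - γ ≤ ‖wP d D y - κ • eP d D‖ ∧ ‖wP d D y - κ • eP d D‖ ≤ σ + 2 * γ := by
    intro M M' hne hM hM' hy hy'
    simp only [tubeNbhd, Set.mem_ofPred_eq, not_le] at hy hy'
    obtain ⟨s, hs, hs1, hs2⟩ : ∃ s, σ < s ∧ s ≤ σ + γ ∧ s ≤ infDist y M' :=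
      ⟨min (σ + γ) (infDist y M'), by simp [hγ, hy'], by simp, by simp⟩
    obtain ⟨p, hp, hps⟩ := (infDist_lt_iff hne).1 (lt_of_le_of_lt hy hs)
    have hfar : ∀ q ∈ M', s ≤ dist y q := fun q hq => hs2.trans (infDist_le_dist_of_mem hq)
    have hw : ∀ h', κ ≤ h' → h' ≤ κ + γ →
        ‖(wP d D y - κ • eP d D) - (wP d D y - h' • eP d D)‖ ≤ γ := by
      intro h' a b
      have : (wP d D y - κ • eP d D) - (wP d D y - h' • eP d D) = (h' - κ) • eP d D := by
        rw [sub_smul]; abel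
      rw [this, norm_smul, eP_norm d D hdD, Real.norm_of_nonneg (by linarith)]
      linarith
    obtain ⟨u', h', hu', ha, hb, rfl⟩ := hM p hp (fun hh => absurd (hfar p hh) (by linarith))
    refine core _ u' _ s γ σ r hγ hσ hγσ hs hs1 h48 (norm_nonneg _) hr hu'
      ⟨‖wP d D y - h' • eP d D‖, norm_nonneg _, ?_, ?_⟩ ?_
    · have := norm_sub_norm_le (wP d D y - κ • eP d D) (wP d D y - h' • eP d D)
      linarith [hw h' ha hb]
    · rw [← dist_sq_bump]
      exact pow_lt_pow_left₀ hps dist_nonneg (by norm_num)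
    · intro u'' hu''
      obtain ⟨h2, ha2, hb2, hm⟩ := hM' u'' hu''
      refine ⟨‖wP d D y - h2 • eP d D‖, norm_nonneg _, ?_, ?_⟩
      · have := norm_sub_norm_le (wP d D y - h2 • eP d D) (wP d D y - κ • eP d D)
        rw [norm_sub_rev (wP d D y - h2 • eP d D) (wP d D y - κ • eP d D)] at this
        linarith [hw h2 ha2 hb2]
      · rw [← dist_sq_bump]
        exact pow_le_pow_left₀ (by linarith) (hfar _ hm) 2
  have fin : ∀ {P : Prop}, (‖uP d D hdD y‖ ^ 2 ≤ 2 * (r ^ 2 + 12 * (γ * σ)) ∧ P) →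
      (‖uP d D hdD y‖ ^ 2 ≤ (8 * κ + 24 * σ) * γ ∧ P) := by
    rintro P ⟨h, hP⟩
    exact ⟨by nlinarith [sq_nonneg γ], hP⟩
  apply fin
  have z1 : ‖(0 : EuclideanSpace ℝ (Fin d))‖ ≤ 1 + κ := by simp; linarith
  rcases hy with ⟨h0, h1⟩ | ⟨h1, h0⟩
  · refine main (bumpM₀ d D κ) (bumpM₁ d D κ γ) ⟨_, 0, z1, Or.inl rfl⟩ ?_ ?_ h0 h1
    · rintro p ⟨u, hu, rfl | rfl⟩ hp
      · have hur : ‖u‖ ≤ r := by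
          by_contra hc
          push Not at hc
          exact hp ⟨u, hu, Or.inl (by rw [hBA u hc])⟩
        exact ⟨u, _, hur, by rw [hA u (by linarith)], by rw [hA u (by linarith)]; linarith, rfl⟩
      · exact (hp ⟨u, hu, Or.inr rfl⟩).elim
    · intro u hu
      have := bumpB_bounds d κ γ u hκ hγ hγκ hu
      exact ⟨_, this.1, this.2, u, by linarith, Or.inl rfl⟩
  · refine main (bumpM₁ d D κ γ) (bumpM₀ d D κ) ⟨_, 0, z1, Or.inl rfl⟩ ?_ ?_ h1 h0
    · rintro p ⟨u, hu, rfl | rfl⟩ hp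
      · have hur : ‖u‖ ≤ r := by
          by_contra hc
          push Not at hc
          exact hp ⟨u, hu, Or.inl (by rw [hBA u hc])⟩
        have := bumpB_bounds d κ γ u hκ hγ hγκ (by linarith)
        exact ⟨u, _, hur, this.1, this.2, rfl⟩
      · exact (hp ⟨u, hu, Or.inr rfl⟩).elim
    · intro u hu
      exact ⟨κ, le_rfl, by linarith, u, by linarith, Or.inl (by rw [hA u hu])⟩

lemma annulus {ι : Type*} [Fintype ι] [Nonempty ι] (c : EuclideanSpace ℝ ι) (σ γ : ℝ)
    (hγ : 0 < γ) (hγσ : γ ≤ σ) :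
    volume {w : EuclideanSpace ℝ ι | σ - γ ≤ ‖w - c‖ ∧ ‖w - c‖ ≤ σ + 2 * γ} ≤
      ENNReal.ofReal (3 * Fintype.card ι * (3 * σ) ^ (Fintype.card ι - 1) *
        (volume (ball (0 : EuclideanSpace ℝ ι) 1)).toReal * γ) := by
  set m := Fintype.card ι
  set V := volume (ball (0 : EuclideanSpace ℝ ι) 1) with hV
  have hVt : V ≠ ⊤ := measure_ball_lt_top.ne
  have hsub : {w : EuclideanSpace ℝ ι | σ - γ ≤ ‖w - c‖ ∧ ‖w - c‖ ≤ σ + 2 * γ} ⊆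
      closedBall c (σ + 2 * γ) \ ball c (σ - γ) := by
    intro w hw
    simp only [Set.mem_sdiff, mem_closedBall, mem_ball, dist_eq_norm, not_lt]
    exact ⟨hw.2, hw.1⟩
  refine (measure_mono hsub).trans ?_
  rw [measure_sdiff (ball_subset_closedBall.trans (closedBall_subset_closedBall (by linarith)))
    measurableSet_ball.nullMeasurableSet measure_ball_lt_top.ne,
    Measure.addHaar_closedBall _ _ (by linarith), Measure.addHaar_ball _ c (r := σ - γ) (by linarith),
    finrank_euclideanSpace, ← hV]
  rw [show V = ENNReal.ofReal V.toReal from (ENNReal.ofReal_toReal hVt).symm,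
    ← ENNReal.ofReal_mul (by apply pow_nonneg; linarith),
    ← ENNReal.ofReal_mul (by apply pow_nonneg; linarith),
    ← ENNReal.ofReal_sub _ (by apply mul_nonneg (pow_nonneg (by linarith) _) ENNReal.toReal_nonneg),
    ENNReal.toReal_ofReal ENNReal.toReal_nonneg]
  apply ENNReal.ofReal_le_ofReal
  have hkey : (σ + 2 * γ) ^ m - (σ - γ) ^ m ≤ 3 * γ * (m * (3 * σ) ^ (m - 1)) := by
    rw [← Commute.mul_geom_sum₂ (Commute.all _ _)]
    have e : σ + 2 * γ - (σ - γ) = 3 * γ := by ring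
    rw [e]
    gcongr
    calc _ ≤ ∑ i ∈ Finset.range m, (3 * σ) ^ (m - 1) := by
          apply Finset.sum_le_sum
          intro i hi
          have hi' := Finset.mem_range.1 hi
          have : (3 * σ) ^ (m - 1) = (3 * σ) ^ i * (3 * σ) ^ (m - 1 - i) := by
            rw [← pow_add]; congr 1; omega
          rw [this]
          have : 0 ≤ σ - γ := by linarith
          have hs0 : 0 < σ := by linarith
          gcongr <;> linarith
      _ = _ := by simp
  have := mul_le_mul_of_nonneg_right hkey (ENNReal.toReal_nonneg (a := V))
  nlinarith

lemma prodvol (d D : ℕ) (hdD : d < D) (ρ : ℝ)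
    (T : Set (EuclideanSpace ℝ {i : Fin D // ¬ (i : ℕ) < d})) :
    volume {y : EuclideanSpace ℝ (Fin D) | ‖uP d D hdD y‖ ≤ ρ ∧ wP d D y ∈ T} ≤
      ENNReal.ofReal (2 * ρ) ^ d * volume T := by
  have e1 := PiLp.volume_preserving_ofLp (Fin D)
  have e2 := volume_preserving_piEquivPiSubtypeProd (fun _ : Fin D => ℝ) (fun i => (i : ℕ) < d)
  have e3 := PiLp.volume_preserving_toLp {i : Fin D // ¬ (i : ℕ) < d}
  have e4 := e2.comp e1
  set B : Set ({i : Fin D // (i : ℕ) < d} → ℝ) := Set.pi Set.univ fun _ => Set.Icc (-ρ) ρ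
  set T' : Set ({i : Fin D // ¬ (i : ℕ) < d} → ℝ) := (WithLp.toLp 2) ⁻¹' T
  have hT' : volume T' = volume T := by
    exact e3.measure_preimage_equiv (f := MeasurableEquiv.toLp 2 _) T
  have hsub : {y : EuclideanSpace ℝ (Fin D) | ‖uP d D hdD y‖ ≤ ρ ∧ wP d D y ∈ T} ⊆
      ((MeasurableEquiv.piEquivPiSubtypeProd (fun _ : Fin D => ℝ) (fun i => (i : ℕ) < d)) ∘
        (WithLp.ofLp)) ⁻¹' (B ×ˢ T') := by
    rintro y ⟨h1, h2⟩
    refine ⟨?_, h2⟩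
    intro i _
    have := (PiLp.norm_apply_le (uP d D hdD y) ⟨i.1, i.2⟩).trans h1
    rw [Real.norm_eq_abs] at this
    exact abs_le.1 this
  refine (measure_mono hsub).trans ?_
  have := e4.measure_preimage_equiv
    (f := (MeasurableEquiv.toLp 2 _).symm.trans (MeasurableEquiv.piEquivPiSubtypeProd (fun _ : Fin D => ℝ) (fun i => (i : ℕ) < d))) (B ×ˢ T')
  refine this.le.trans ?_
  rw [Measure.volume_eq_prod, Measure.prod_prod, hT', volume_pi_pi]
  have hc : Fintype.card {i : Fin D // (i : ℕ) < d} = d := by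
    rw [← Fintype.card_congr (castEq d D hdD), Fintype.card_fin]
  simp only [Real.volume_Icc, Finset.prod_const, Finset.card_univ, hc]
  rw [show ρ - -ρ = 2 * ρ by ring]

/-- **Volume of the symmetric difference of the tubes (Theorem 5, part 3 / appendix).**
For `1 ≤ d < D`, `κ > 0`, `0 < σ < κ`, there are constants `C > 0` and `γ₀ > 0`
(depending only on `κ, σ, d, D`) such that for all `0 < γ ≤ γ₀`,
`V((M₀ ⊕ σ) △ (M₁ ⊕ σ)) ≤ C γ^{(d+2)/2}`. -/
theorem bump_tube_symmDiff_volume (d D : ℕ) (hd : 1 ≤ d) (hdD : d < D)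
    (κ σ : ℝ) (hκ : 0 < κ) (hσ : 0 < σ) (hσκ : σ < κ) :
    ∃ C > (0 : ℝ), ∃ γ₀ > (0 : ℝ), ∀ γ : ℝ, 0 < γ → γ ≤ γ₀ →
      volume (symmDiff (tubeNbhd (bumpM₀ d D κ) σ) (tubeNbhd (bumpM₁ d D κ γ) σ)) ≤
        ENNReal.ofReal (C * γ ^ (((d : ℝ) + 2) / 2)) := by
  haveI : Nonempty {i : Fin D // ¬ (i : ℕ) < d} := ⟨⟨⟨d, hdD⟩, by simp⟩⟩
  set A : ℝ := 3 * Fintype.card {i : Fin D // ¬ (i : ℕ) < d} *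
    (3 * σ) ^ (Fintype.card {i : Fin D // ¬ (i : ℕ) < d} - 1) *
        (volume (ball (0 : EuclideanSpace ℝ {i : Fin D // ¬ (i : ℕ) < d}) 1)).toReal with hA
  have hA0 : 0 ≤ A := by positivity
  set K : ℝ := √(8 * κ + 24 * σ) with hK
  have hK0 : 0 ≤ K := Real.sqrt_nonneg _
  refine ⟨(2 * K) ^ d * A + 1, by positivity,
    min (min κ σ) (min (1 / (48 * σ)) (1 / (16 * κ))), by positivity, ?_⟩
  intro γ hγ hγ₀
  simp only [le_min_iff] at hγ₀
  obtain ⟨⟨hγκ, hγσ⟩, h48, h16⟩ := hγ₀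
  rw [le_div_iff₀ (by positivity)] at h48 h16
  have hsub : symmDiff (tubeNbhd (bumpM₀ d D κ) σ) (tubeNbhd (bumpM₁ d D κ γ) σ) ⊆
      {y : EuclideanSpace ℝ (Fin D) | ‖uP d D hdD y‖ ≤ K * √γ ∧ wP d D y ∈
        {w | σ - γ ≤ ‖w - κ • eP d D‖ ∧ ‖w - κ • eP d D‖ ≤ σ + 2 * γ}} := by
    intro y hy
    obtain ⟨h1, h2⟩ := geom d D hdD κ σ γ hκ hσ hγ hγκ hγσ (by linarith) (by linarith) y hy
    refine ⟨?_, h2⟩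
    rw [hK, ← Real.sqrt_mul (by positivity)]
    exact Real.le_sqrt_of_sq_le h1
  refine (measure_mono hsub).trans ((prodvol d D hdD _ _).trans ?_)
  refine (mul_le_mul_right (annulus (κ • eP d D) σ γ hγ hγσ) _).trans ?_
  rw [← hA, ← ENNReal.ofReal_pow (by positivity), ← ENNReal.ofReal_mul (by positivity)]
  apply ENNReal.ofReal_le_ofReal
  have hpow : γ ^ (((d : ℝ) + 2) / 2) = √γ ^ d * γ := by
    rw [show ((d : ℝ) + 2) / 2 = (1 / 2) * d + 1 by ring, Real.rpow_add hγ, Real.rpow_one,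
      Real.rpow_mul hγ.le, Real.rpow_natCast, Real.sqrt_eq_rpow]
  rw [hpow]
  have : 0 ≤ √γ ^ d * γ := by positivity
  calc (2 * (K * √γ)) ^ d * (A * γ) = (2 * K) ^ d * A * (√γ ^ d * γ) := by
        rw [← mul_assoc 2 K, mul_pow]; ring
    _ ≤ _ := by linarith
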